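/- Let T=(V,p) be a leafless, locally countable directed forest. Then the following conditions are equivalent: (a) every bounded hyponormal weighted shift on T is power hyponormal; (b) for every bounded hyponormal weighted shift S_λ on T, the square S_λ² is hyponormal; (c) T is a forkless forest. Moreover, conditions (a) and (b) remain equivalent (to each other and to (c)) when restricted to proper bounded weighted shifts. -/

import Mathlib

open scoped ENNReal Classical
noncomputable section

universe u

namespace ShiftsPaper

/-- ℓ²(V) over ℂ. -/
abbrev Hs (V : Type u) : Type u := lp (fun _ : V => ℂ) 2

/-- canonical orthonormal basis vector -/
def ev {V : Type u} (v : V) : Hs V := lp.single 2 v 1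

/-- A directed forest: a nonempty vertex set together with a parent function `p`
such that any vertex lying on a `p`-cycle is a fixed point of `p`. -/
def IsDirectedForest {V : Type u} (p : V → V) : Prop :=
  Nonempty V ∧ ∀ n : ℕ, 1 ≤ n → ∀ v : V, p^[n] v = v → p v = v

def rootSet {V : Type u} (p : V → V) : Set V := {v | p v = v}

def children {V : Type u} (p : V → V) (v : V) : Set V := {u | p u = v ∧ u ≠ v}

/-- the set of `k`-th children `Chi^⟨k⟩(v)` -/
def childrenIter {V : Type u} (p : V → V) : ℕ → V → Set V
  | 0, v => {v}
  | k + 1, v => {u | p^[k + 1] u = v ∧ p^[k] u ≠ v}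

/-- descendants -/
def des {V : Type u} (p : V → V) (v : V) : Set V := ⋃ n : ℕ, childrenIter p n v

lemma self_mem_des {V : Type u} (p : V → V) (v : V) : v ∈ des p v :=
  Set.mem_iUnion.2 ⟨0, by simp [childrenIter]⟩

/-- `u` and `v` belong to the same tree (connected component) of the forest -/
def sameTree {V : Type u} (p : V → V) (u v : V) : Prop :=
  ∃ m n : ℕ, p^[m] u = p^[n] v

/-- A directed tree is a connected directed forest. -/
def IsDirectedTree {V : Type u} (p : V → V) : Prop :=
  IsDirectedForest p ∧ ∀ u v : V, sameTree p u v

def Leafless {V : Type u} (p : V → V) : Prop := Function.Surjective p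

def LocallyCountable {V : Type u} (p : V → V) : Prop :=
  ∀ v : V, (children p v).Countable

/-- every non-root vertex has exactly one child -/
def Forkless {V : Type u} (p : V → V) : Prop :=
  ∀ v : V, p v ≠ v → ∃! u : V, u ∈ children p v

/-- a system of weights: vanishing at the roots -/
def WeightSystem {V : Type u} (p : V → V) (lam : V → ℂ) : Prop :=
  ∀ v : V, p v = v → lam v = 0

/-- a proper system of weights: vanishing exactly at the roots -/
def ProperWeights {V : Type u} (p : V → V) (lam : V → ℂ) : Prop :=
  ∀ v : V, lam v = 0 ↔ p v = v

/-- `S` is the (bounded) weighted shift on the forest `(V, p)` with weights `lam`: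
`(S f)(v) = lam v • f (p v)`. -/
def IsWeightedShift {V : Type u} (p : V → V) (lam : V → ℂ)
    (S : Hs V →L[ℂ] Hs V) : Prop :=
  ∀ (f : Hs V) (v : V), (S f : ∀ _ : V, ℂ) v = lam v * (f : ∀ _ : V, ℂ) (p v)

def Hyponormal {E : Type u} [NormedAddCommGroup E] [InnerProductSpace ℂ E]
    [CompleteSpace E] (A : E →L[ℂ] E) : Prop :=
  (ContinuousLinearMap.adjoint A ∘L A - A ∘L ContinuousLinearMap.adjoint A).IsPositive

def PowerHyponormal {E : Type u} [NormedAddCommGroup E] [InnerProductSpace ℂ E]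
    [CompleteSpace E] (A : E →L[ℂ] E) : Prop :=
  ∀ n : ℕ, 1 ≤ n → Hyponormal (A ^ n)

/-- `A` is subnormal: it is the restriction of a bounded normal operator on a larger
Hilbert space to an invariant subspace. -/
def Subnormal {E : Type u} [NormedAddCommGroup E] [InnerProductSpace ℂ E]
    [CompleteSpace E] (A : E →L[ℂ] E) : Prop :=
  ∃ (K : Type u) (_ : NormedAddCommGroup K) (_ : InnerProductSpace ℂ K)
    (_ : CompleteSpace K) (J : E →ₗᵢ[ℂ] K) (N : K →L[ℂ] K),
    IsStarNormal N ∧ ∀ x : E, N (J x) = J (A x)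

/-- `μ` is a representing measure (a positive Borel measure on `[0,∞)`) for the
sequence `a`. -/
def IsRepresentingMeasure (μ : MeasureTheory.Measure ℝ) (a : ℕ → ℝ) : Prop :=
  μ (Set.Iio 0) = 0 ∧
    ∀ n : ℕ, ENNReal.ofReal (a n) = ∫⁻ x : ℝ, ENNReal.ofReal (x ^ n) ∂μ

def IsStieltjesMomentSeq (a : ℕ → ℝ) : Prop :=
  (∀ n, 0 ≤ a n) ∧ ∃ μ : MeasureTheory.Measure ℝ, IsRepresentingMeasure μ a

/-- parent function of the `k`-step backward extension `T⟨k⟩`; the new vertices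
`ω_1, …, ω_k` are encoded as `Sum.inr ⟨0⟩, …, Sum.inr ⟨k-1⟩`. -/
def extParent {V : Type u} (p : V → V) (ω : V) (k : ℕ) :
    V ⊕ Fin k → V ⊕ Fin k
  | Sum.inl v =>
      if v = ω then (if h : 0 < k then Sum.inr ⟨0, h⟩ else Sum.inl ω)
      else Sum.inl (p v)
  | Sum.inr j =>
      if h : (j : ℕ) + 1 < k then Sum.inr ⟨(j : ℕ) + 1, h⟩ else Sum.inr j

/-- weights on `T⟨k⟩`: weight `mu 0 = λ'_{ω_0}` at the old root `ω`, weight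
`mu (j+1) = λ'_{ω_{j+1}}` at `ω_{j+1}` for `j+1 < k`, weight `0` at the new root `ω_k`. -/
def extWeights {V : Type u} (lam : V → ℂ) (ω : V) (k : ℕ) (mu : Fin k → ℂ) :
    V ⊕ Fin k → ℂ
  | Sum.inl v => if v = ω then (if h : 0 < k then mu ⟨0, h⟩ else 0) else lam v
  | Sum.inr j => if h : (j : ℕ) + 1 < k then mu ⟨(j : ℕ) + 1, h⟩ else 0

/-- `S` (the weighted shift with weights `lam` on a tree rooted at `ω`) admits a
subnormal `k`-step backward extension. -/
def AdmitsSubnormalBackExt {V : Type u} (p : V → V) (lam : V → ℂ) (ω : V)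
    (S : Hs V →L[ℂ] Hs V) (k : ℕ) : Prop :=
  Subnormal S ∧
    ∃ mu : Fin k → ℂ, (∀ j, mu j ≠ 0) ∧
      ∃ S' : Hs (V ⊕ Fin k) →L[ℂ] Hs (V ⊕ Fin k),
        IsWeightedShift (extParent p ω k) (extWeights lam ω k mu) S' ∧ Subnormal S'

def AdmitsPowerHypoBackExt {V : Type u} (p : V → V) (lam : V → ℂ) (ω : V)
    (S : Hs V →L[ℂ] Hs V) (k : ℕ) : Prop :=
  PowerHyponormal S ∧
    ∃ mu : Fin k → ℂ, (∀ j, mu j ≠ 0) ∧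
      ∃ S' : Hs (V ⊕ Fin k) →L[ℂ] Hs (V ⊕ Fin k),
        IsWeightedShift (extParent p ω k) (extWeights lam ω k mu) S' ∧
        PowerHyponormal S'

/-- the parent function of the subforest `T|_W`. -/
def restrictParent {V : Type u} (p : V → V) (W : Set V) : W → W :=
  fun v => if h : p ↑v ∈ W then ⟨p ↑v, h⟩ else v

/-- the weights `λ→_u` on the subtree `T_(u→)` of descendants of `u`. -/
def subWeights {V : Type u} (lam : V → ℂ) (u : V) (W : Set V) : W → ℂ :=
  fun v => if (v : V) = u then 0 else lam ↑v

/-- parent function of the rooted sum of the family `{(V j, p j)}` with roots `ω j`;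
the new root is `none`. -/
def rsParent {J : Type u} {V : J → Type u} (p : ∀ j, V j → V j) (ω : ∀ j, V j) :
    Option (Σ j, V j) → Option (Σ j, V j)
  | none => none
  | some ⟨j, v⟩ => if v = ω j then none else some ⟨j, p j v⟩

/-- weights on the rooted sum: `0` at the new root, `θ j` at the old root `ω j`. -/
def rsWeights {J : Type u} {V : J → Type u} (lam : ∀ j, V j → ℂ) (ω : ∀ j, V j)
    (θ : J → ℂ) : Option (Σ j, V j) → ℂ
  | none => 0
  | some ⟨j, v⟩ => if v = ω j then θ j else lam j v

/-- iterated weights `λ^(k)_v`. -/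
def iterWeight {V : Type u} (p : V → V) (lam : V → ℂ) : ℕ → V → ℂ
  | 0, _ => 1
  | k + 1, v => iterWeight p lam k (p v) * lam v

/-- parent function `p^[k]` of the `k`-th power forest `T^k`. -/
def kPowParent {V : Type u} (p : V → V) (k : ℕ) (v : V) : V :=
  if p (p^[k - 1] v) = p^[k - 1] v then v else p^[k] v


/-! ### Auxiliary lemmas -/

lemma ev_apply {V : Type u} (u v : V) :
    (ev u : ∀ _ : V, ℂ) v = if v = u then 1 else 0 := by
  simp only [ev, lp.single_apply, Pi.single_apply]

lemma norm_ev {V : Type u} (u : V) : ‖ev u‖ = 1 := by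
  simp [ev, lp.norm_single]

lemma inner_ev {V : Type u} (u : V) (x : Hs V) :
    inner ℂ (ev u) x = (x : ∀ _ : V, ℂ) u := by
  simp [ev, lp.inner_single_left]

lemma sum_sq_le {V : Type u} (x : Hs V) (F : Finset V) :
    ∑ v ∈ F, ‖(x : ∀ _ : V, ℂ) v‖ ^ 2 ≤ ‖x‖ ^ 2 := by
  have := lp.sum_rpow_le_norm_rpow (p := 2) (by simp) x F
  simpa using this

lemma norm_sq_le_of {V : Type u} (x : Hs V) (C : ℝ) (hC : 0 ≤ C)
    (h : ∀ F : Finset V, ∑ v ∈ F, ‖(x : ∀ _ : V, ℂ) v‖ ^ 2 ≤ C) : ‖x‖ ^ 2 ≤ C := by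
  have := lp.norm_le_of_forall_sum_le (p := 2) (by simp) (Real.sqrt_nonneg C) (f := x)
    (by
      intro s
      have := h s
      simpa [Real.sq_sqrt hC] using this)
  calc ‖x‖ ^ 2 ≤ (Real.sqrt C) ^ 2 := by gcongr
    _ = C := Real.sq_sqrt hC

lemma pythag {E : Type*} [NormedAddCommGroup E] [InnerProductSpace ℂ E] {ι : Type*}
    (x : ι → E) (h : ∀ i j, i ≠ j → inner ℂ (x i) (x j) = 0) (F : Finset ι) :
    ‖∑ i ∈ F, x i‖ ^ 2 = ∑ i ∈ F, ‖x i‖ ^ 2 := by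
  induction F using Finset.induction_on with
  | empty => simp
  | insert a s ha ih =>
    rw [Finset.sum_insert ha, Finset.sum_insert ha, ← ih, @norm_add_sq ℂ]
    have : inner ℂ (x a) (∑ i ∈ s, x i) = 0 := by
      rw [inner_sum]
      refine Finset.sum_eq_zero fun j hj => h a j ?_
      rintro rfl
      exact ha hj
    rw [this]
    simp

lemma hypo_iff {E : Type u} [NormedAddCommGroup E] [InnerProductSpace ℂ E]
    [CompleteSpace E] (A : E →L[ℂ] E) :
    Hyponormal A ↔ ∀ x, ‖ContinuousLinearMap.adjoint A x‖ ^ 2 ≤ ‖A x‖ ^ 2 := by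
  have key : ∀ x, (ContinuousLinearMap.adjoint A ∘L A -
      A ∘L ContinuousLinearMap.adjoint A).reApplyInnerSelf x =
      ‖A x‖ ^ 2 - ‖ContinuousLinearMap.adjoint A x‖ ^ 2 := by
    intro x
    rw [ContinuousLinearMap.reApplyInnerSelf_apply]
    simp only [_root_.sub_apply, ContinuousLinearMap.comp_apply, inner_sub_left,
      map_sub, ContinuousLinearMap.adjoint_inner_left]
    have h2 : inner ℂ (A (ContinuousLinearMap.adjoint A x)) x =
        inner ℂ (ContinuousLinearMap.adjoint A x) (ContinuousLinearMap.adjoint A x) :=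
      (ContinuousLinearMap.adjoint_inner_right A _ _).symm
    rw [h2, inner_self_eq_norm_sq, inner_self_eq_norm_sq]
  unfold Hyponormal
  rw [ContinuousLinearMap.isPositive_def']
  constructor
  · rintro ⟨-, h⟩ x
    have := h x
    rw [key] at this
    linarith
  · intro h
    refine ⟨?_, fun x => by rw [key]; linarith [h x]⟩
    have h1 : IsSelfAdjoint (ContinuousLinearMap.adjoint A ∘L A) :=
      IsSelfAdjoint.star_mul_self A
    have h2 : IsSelfAdjoint (A ∘L ContinuousLinearMap.adjoint A) :=
      IsSelfAdjoint.mul_star_self A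
    exact h1.sub h2

section crit

variable {V : Type u} {q : V → V} {w : V → ℂ} {A : Hs V →L[ℂ] Hs V}

lemma adj_ev (hA : IsWeightedShift q w A) (u : V) :
    ContinuousLinearMap.adjoint A (ev u) = (starRingEnd ℂ (w u)) • ev (q u) := by
  ext v
  rw [← inner_ev v, ContinuousLinearMap.adjoint_inner_right]
  rw [← inner_conj_symm, inner_ev, hA, ev_apply]
  simp only [lp.coeFn_smul, Pi.smul_apply, ev_apply, smul_eq_mul, map_mul]
  by_cases h : v = q u
  · subst h; simp
  · have : ¬ q u = v := fun h' => h h'.symm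
    simp [h, this]

lemma shift_orth (hA : IsWeightedShift q w A) (u v : V) (huv : u ≠ v) :
    inner ℂ (A (ev u)) (A (ev v)) = 0 := by
  rw [lp.inner_eq_tsum]
  have : ∀ x, inner ℂ ((A (ev u) : ∀ _ : V, ℂ) x) ((A (ev v) : ∀ _ : V, ℂ) x) = 0 := by
    intro x
    rw [hA, hA, ev_apply, ev_apply]
    by_cases h : q x = u
    · have : ¬ q x = v := fun h' => huv (h.symm.trans h')
      simp [this]
    · simp [h]
  simp only [this, tsum_zero]

lemma ev_orth (u v : V) (huv : u ≠ v) : inner ℂ (ev u) (ev v) = 0 := by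
  rw [inner_ev, ev_apply, if_neg huv]

lemma norm_sq_shift_sum (hA : IsWeightedShift q w A) (F : Finset V) (f : V → ℂ) :
    ‖A (∑ u ∈ F, f u • ev u)‖ ^ 2 = ∑ u ∈ F, ‖f u‖ ^ 2 * ‖A (ev u)‖ ^ 2 := by
  rw [map_sum]
  simp only [map_smul]
  rw [pythag]
  · simp [norm_smul, mul_pow]
  · intro i j hij
    rw [inner_smul_left, inner_smul_right, shift_orth hA i j hij]
    simp

/-- local criterion for hyponormality of a weighted composition operator -/
lemma crit (hA : IsWeightedShift q w A) :
    Hyponormal A ↔ ∀ (v : V) (F : Finset V) (f : V → ℂ), (∀ u ∈ F, q u = v) →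
      ‖∑ u ∈ F, starRingEnd ℂ (w u) * f u‖ ^ 2 ≤ ∑ u ∈ F, ‖f u‖ ^ 2 * ‖A (ev u)‖ ^ 2 := by
  rw [hypo_iff]
  constructor
  · intro h v F f hF
    have h1 := h (∑ u ∈ F, f u • ev u)
    rw [norm_sq_shift_sum hA] at h1
    refine le_trans (le_of_eq ?_) h1
    rw [map_sum]
    have : ∑ u ∈ F, ContinuousLinearMap.adjoint A (f u • ev u) =
        (∑ u ∈ F, starRingEnd ℂ (w u) * f u) • ev v := by
      rw [Finset.sum_smul]
      refine Finset.sum_congr rfl fun u hu => ?_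
      rw [map_smul, adj_ev hA, hF u hu, smul_smul, mul_comm]
    rw [this, norm_smul, norm_ev, mul_one]
  · intro h
    have fin : ∀ (F : Finset V) (f : V → ℂ),
        ‖ContinuousLinearMap.adjoint A (∑ u ∈ F, f u • ev u)‖ ^ 2 ≤
          ‖A (∑ u ∈ F, f u • ev u)‖ ^ 2 := by
      intro F f
      rw [norm_sq_shift_sum hA, map_sum]
      have : ∑ u ∈ F, ContinuousLinearMap.adjoint A (f u • ev u) =
          ∑ v ∈ F.image q, (∑ u ∈ F with q u = v, starRingEnd ℂ (w u) * f u) • ev v := by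
        rw [← Finset.sum_fiberwise_of_maps_to (s := F) (t := F.image q) (g := q)
          (fun u hu => Finset.mem_image_of_mem q hu)]
        refine Finset.sum_congr rfl fun v hv => ?_
        rw [Finset.sum_smul]
        refine Finset.sum_congr rfl fun u hu => ?_
        rw [map_smul, adj_ev hA, (Finset.mem_filter.1 hu).2, smul_smul, mul_comm]
      rw [this, pythag]
      · rw [← Finset.sum_fiberwise_of_maps_to (s := F) (t := F.image q) (g := q)
          (fun u hu => Finset.mem_image_of_mem q hu)
          (f := fun u => ‖f u‖ ^ 2 * ‖A (ev u)‖ ^ 2)]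
        refine Finset.sum_le_sum fun v hv => ?_
        rw [norm_smul, norm_ev, mul_one]
        exact h v _ f fun u hu => (Finset.mem_filter.1 hu).2
      · intro i j hij
        rw [inner_smul_left, inner_smul_right, ev_orth i j hij]
        simp
    intro x
    have hx : HasSum (fun u : V => lp.single 2 u ((x : ∀ _ : V, ℂ) u)) x :=
      lp.hasSum_single (by simp) x
    have hx' : HasSum (fun u : V => ((x : ∀ _ : V, ℂ) u) • ev u) x := by
      convert hx using 2 with u
      rw [ev, ← lp.single_smul]
      simp
    refine le_of_tendsto_of_tendsto'
      (((ContinuousLinearMap.adjoint A).continuous.tendsto x).comp hx' |>.norm |>.pow 2)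
      ((A.continuous.tendsto x).comp hx' |>.norm |>.pow 2) ?_
    intro F
    exact fin F _

end crit

/-- the elementary norm estimate -/
lemma sum_bound {V : Type u} (p : V → V) (lam : V → ℂ) (f : Hs V) (K : ℝ) (hK : 0 ≤ K)
    (h : ∀ v, (f : ∀ _ : V, ℂ) v ≠ 0 → ∀ F : Finset V, (∀ u ∈ F, p u = v) →
      ∑ u ∈ F, ‖lam u‖ ^ 2 ≤ K) (F : Finset V) :
    ∑ u ∈ F, ‖lam u * (f : ∀ _ : V, ℂ) (p u)‖ ^ 2 ≤ K * ‖f‖ ^ 2 := by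
  rw [← Finset.sum_fiberwise_of_maps_to (s := F) (t := F.image p) (g := p)
          (fun u hu => Finset.mem_image_of_mem p hu)]
  calc _ ≤ ∑ v ∈ F.image p, K * ‖(f : ∀ _ : V, ℂ) v‖ ^ 2 := by
        refine Finset.sum_le_sum fun v hv => ?_
        have : ∑ u ∈ F with p u = v, ‖lam u * (f : ∀ _ : V, ℂ) (p u)‖ ^ 2 =
            (∑ u ∈ F with p u = v, ‖lam u‖ ^ 2) * ‖(f : ∀ _ : V, ℂ) v‖ ^ 2 := by
          rw [Finset.sum_mul]
          refine Finset.sum_congr rfl fun u hu => ?_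
          rw [(Finset.mem_filter.1 hu).2, norm_mul, mul_pow]
        rw [this]
        by_cases h0 : (f : ∀ _ : V, ℂ) v = 0
        · simp [h0]
        · gcongr
          exact h v h0 _ fun u hu => (Finset.mem_filter.1 hu).2
    _ = K * ∑ v ∈ F.image p, ‖(f : ∀ _ : V, ℂ) v‖ ^ 2 := by rw [Finset.mul_sum]
    _ ≤ _ := by
        gcongr
        exact sum_sq_le f _

lemma exists_shift {V : Type u} (p : V → V) (lam : V → ℂ) (K : ℝ) (hK : 0 ≤ K)
    (h : ∀ v, ∀ F : Finset V, (∀ u ∈ F, p u = v) → ∑ u ∈ F, ‖lam u‖ ^ 2 ≤ K) :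
    ∃ S : Hs V →L[ℂ] Hs V, IsWeightedShift p lam S := by
  have mem : ∀ f : Hs V, Memℓp (fun u : V => lam u * (f : ∀ _ : V, ℂ) (p u)) 2 := by
    intro f
    refine memℓp_gen' (C := K * ‖f‖ ^ 2) fun s => ?_
    have := sum_bound p lam f K hK (fun v _ => h v) s
    simpa using this
  let L : Hs V →ₗ[ℂ] Hs V :=
    { toFun := fun f => ⟨fun u : V => lam u * (f : ∀ _ : V, ℂ) (p u), mem f⟩
      map_add' := by
        intro f g
        ext v
        simp [mul_add]
        rfl
      map_smul' := by
        intro c f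
        ext v
        simp
        ring }
  have hL : ∀ (f : Hs V) (v : V), (L f : ∀ _ : V, ℂ) v = lam v * (f : ∀ _ : V, ℂ) (p v) :=
    fun f v => rfl
  refine ⟨L.mkContinuous (Real.sqrt K) ?_, hL⟩
  intro f
  have h2 := norm_sq_le_of (L f) (K * ‖f‖ ^ 2) (by positivity)
    (fun F => sum_bound p lam f K hK (fun v _ => h v) F)
  rw [← Real.sqrt_sq (norm_nonneg (L f)), ← Real.sqrt_sq (norm_nonneg f),
    ← Real.sqrt_mul hK]
  exact Real.sqrt_le_sqrt h2

lemma norm_shift_sq_le {V : Type u} {p : V → V} {lam : V → ℂ} {S : Hs V →L[ℂ] Hs V}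
    (hS : IsWeightedShift p lam S) (f : Hs V) (K : ℝ) (hK : 0 ≤ K)
    (h : ∀ v, (f : ∀ _ : V, ℂ) v ≠ 0 → ∀ F : Finset V, (∀ u ∈ F, p u = v) →
      ∑ u ∈ F, ‖lam u‖ ^ 2 ≤ K) : ‖S f‖ ^ 2 ≤ K * ‖f‖ ^ 2 := by
  refine norm_sq_le_of _ _ (by positivity) fun F => ?_
  simp only [hS f]
  exact sum_bound p lam f K hK h F

lemma fiber_sum_le {V : Type u} {p : V → V} {lam : V → ℂ} {S : Hs V →L[ℂ] Hs V}
    (hS : IsWeightedShift p lam S) (v : V) (F : Finset V) (hF : ∀ u ∈ F, p u = v) :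
    ∑ u ∈ F, ‖lam u‖ ^ 2 ≤ ‖S (ev v)‖ ^ 2 := by
  refine le_trans (le_of_eq ?_) (sum_sq_le _ F)
  refine Finset.sum_congr rfl fun u hu => ?_
  rw [hS, hF u hu, ev_apply]
  simp

/-! ### Forkless forests -/

lemma pow_shift {V : Type u} {p : V → V} {lam : V → ℂ} {S : Hs V →L[ℂ] Hs V}
    (hS : IsWeightedShift p lam S) (n : ℕ) :
    IsWeightedShift (p^[n]) (iterWeight p lam n) (S ^ n) := by
  induction n with
  | zero => intro f v; simp [iterWeight]
  | succ n ih =>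
    intro f v
    rw [pow_succ', _root_.mul_apply_eq_comp, hS, ih, iterWeight, Function.iterate_succ_apply]
    ring

lemma iterWeight_succ' {V : Type u} (p : V → V) (lam : V → ℂ) (n : ℕ) (v : V) :
    iterWeight p lam (n + 1) v = iterWeight p lam n v * lam (p^[n] v) := by
  induction n generalizing v with
  | zero => simp [iterWeight]
  | succ n ih =>
    rw [iterWeight, ih, iterWeight, Function.iterate_succ_apply]
    ring

lemma nonroot_of_iter {V : Type u} {p : V → V} {m : ℕ} {u : V}
    (h : p (p^[m] u) ≠ p^[m] u) : p u ≠ u := by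
  intro h0
  apply h
  rw [Function.iterate_fixed h0, h0]

lemma iter_inj {V : Type u} {p : V → V} (hfk : Forkless p) (m : ℕ) (u u' : V)
    (h : p (p^[m] u) ≠ p^[m] u) (heq : p^[m] u = p^[m] u') : u = u' := by
  induction m generalizing u u' with
  | zero => simpa using heq
  | succ m ih =>
    simp only [Function.iterate_succ_apply] at h heq
    have h1 := ih _ _ h heq
    have h2 := nonroot_of_iter h
    obtain ⟨c, hc, huniq⟩ := hfk (p u) h2
    have e1 : u = c := huniq u ⟨rfl, fun e => h2 (congrArg p e.symm)⟩
    have e2 : u' = c := huniq u' ⟨h1.symm, fun e => h2 ((congrArg p e.symm).trans h1.symm)⟩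
    rw [e1, e2]

section fk

variable {V : Type u} {p : V → V} {lam : V → ℂ} {S : Hs V →L[ℂ] Hs V}

lemma lam_le (hS : IsWeightedShift p lam S) (hyp : Hyponormal S) (u : V) :
    ‖lam u‖ ≤ ‖S (ev u)‖ := by
  have := (crit hS).1 hyp (p u) {u} (fun _ => 1) (by simp)
  simp at this
  exact (sq_le_sq₀ (norm_nonneg _) (norm_nonneg _)).1 this

lemma S_ev (hfk : Forkless p) (hS : IsWeightedShift p lam S) (x : V) (hx : p (p x) ≠ p x) :
    S (ev (p x)) = lam x • ev x := by
  ext v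
  rw [hS, ev_apply]
  simp only [lp.coeFn_smul, Pi.smul_apply, ev_apply, smul_eq_mul]
  by_cases h : v = x
  · subst h; simp
  · have : ¬ p v = p x := by
      intro h'
      exact h (iter_inj hfk 1 v x (by simpa [h'] using hx) (by simpa using h'))
    simp [h, this]

lemma D_eq (hfk : Forkless p) (hS : IsWeightedShift p lam S) (x : V) (hx : p (p x) ≠ p x) :
    ‖S (ev (p x))‖ = ‖lam x‖ := by
  rw [S_ev hfk hS x hx, norm_smul, norm_ev, mul_one]

lemma claim1 (hfk : Forkless p) (hS : IsWeightedShift p lam S) (hyp : Hyponormal S)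
    (m : ℕ) (u : V) (h : p (p^[m] u) ≠ p^[m] u) :
    ‖S (ev (p^[m] u))‖ ≤ ‖S (ev u)‖ ∧ ‖iterWeight p lam m u‖ ≤ ‖S (ev u)‖ ^ m := by
  induction m generalizing u with
  | zero => simp [iterWeight]
  | succ m ih =>
    rw [Function.iterate_succ_apply] at h ⊢
    obtain ⟨h1, h2⟩ := ih _ h
    have h3 := nonroot_of_iter h
    have h4 : ‖S (ev (p u))‖ ≤ ‖S (ev u)‖ := by
      rw [D_eq hfk hS u h3]
      exact lam_le hS hyp u
    refine ⟨h1.trans h4, ?_⟩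
    rw [iterWeight, norm_mul, pow_succ]
    have := lam_le hS hyp u
    gcongr
    exact h2.trans (by gcongr)

lemma claim2 (hfk : Forkless p) (hl : Leafless p) (hS : IsWeightedShift p lam S)
    (hyp : Hyponormal S) (n : ℕ) (u : V) (h : p u ≠ u) :
    ‖S (ev u)‖ ^ n ≤ ‖(S ^ n) (ev u)‖ := by
  induction n generalizing u with
  | zero => simp [norm_ev]
  | succ n ih =>
    obtain ⟨c, rfl⟩ := hl u
    have hc : p c ≠ c := fun e => h (congrArg p e)
    rw [pow_succ S, _root_.mul_apply_eq_comp, S_ev hfk hS c h, map_smul, norm_smul,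
      norm_smul, norm_ev, mul_one, pow_succ']
    gcongr
    refine le_trans ?_ (ih c hc)
    have := lam_le hS hyp c
    gcongr

lemma forkless_power (hfk : Forkless p) (hl : Leafless p) (hw : WeightSystem p lam)
    (hS : IsWeightedShift p lam S) (hyp : Hyponormal S) : PowerHyponormal S := by
  intro n hn
  obtain ⟨m, rfl⟩ : ∃ m, n = m + 1 := ⟨n - 1, by omega⟩
  rw [crit (pow_shift hS (m + 1))]
  intro v F f hF
  set F' := F.filter (fun u => iterWeight p lam (m + 1) u ≠ 0) with hF'
  have nr : ∀ u ∈ F', p (p^[m] u) ≠ p^[m] u := by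
    intro u hu e
    apply (Finset.mem_filter.1 hu).2
    rw [iterWeight_succ', hw _ e, mul_zero]
  have inj : Set.InjOn (p^[m]) (F' : Set V) := by
    intro u hu u' hu' e
    exact iter_inj hfk m u u' (nr u hu) e
  have hne : Nonempty V := ⟨v⟩
  have hinv := inj.leftInvOn_invFunOn
  let g : V → ℂ := fun j =>
    starRingEnd ℂ (iterWeight p lam m (Function.invFunOn (p^[m]) (F' : Set V) j)) *
      f (Function.invFunOn (p^[m]) (F' : Set V) j)
  have hg : ∀ u ∈ F', g (p^[m] u) = starRingEnd ℂ (iterWeight p lam m u) * f u := by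
    intro u hu
    have : Function.invFunOn (p^[m]) (F' : Set V) (p^[m] u) = u := hinv hu
    simp only [g, this]
  have key := (crit hS).1 hyp v (F'.image (p^[m])) g (by
    intro j hj
    obtain ⟨u, hu, rfl⟩ := Finset.mem_image.1 hj
    rw [← Function.iterate_succ_apply' p m u]
    exact hF u (Finset.mem_filter.1 hu).1)
  rw [Finset.sum_image inj, Finset.sum_image inj] at key
  have e1 : ∑ u ∈ F, starRingEnd ℂ (iterWeight p lam (m + 1) u) * f u =
      ∑ u ∈ F', starRingEnd ℂ (lam (p^[m] u)) * g (p^[m] u) := by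
    rw [← Finset.sum_subset (Finset.filter_subset _ F : F' ⊆ F)]
    · refine Finset.sum_congr rfl fun u hu => ?_
      rw [hg u hu, iterWeight_succ', map_mul]
      ring
    · intro u hu hu'
      have : iterWeight p lam (m + 1) u = 0 := by
        by_contra h0
        exact hu' (Finset.mem_filter.2 ⟨hu, h0⟩)
      simp [this]
  rw [e1]
  refine key.trans ?_
  refine le_trans ?_ (Finset.sum_le_sum_of_subset_of_nonneg (Finset.filter_subset _ F : F' ⊆ F)
    (fun _ _ _ => by positivity))
  refine Finset.sum_le_sum fun u hu => ?_
  rw [hg u hu, norm_mul, RCLike.norm_conj, mul_pow, mul_comm (_ ^ 2) (‖f u‖ ^ 2), mul_assoc,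
    ← mul_pow]
  obtain ⟨h1, h2⟩ := claim1 hfk hS hyp m u (nr u hu)
  have h3 := claim2 hfk hl hS hyp (m + 1) u (nonroot_of_iter (nr u hu))
  gcongr
  refine le_trans ?_ h3
  rw [pow_succ]
  gcongr

end fk

/-! ### Forests with forks -/

lemma exists_theta {V : Type u} (p : V → V) (hl : Leafless p) (hlc : LocallyCountable p) :
    ∃ θ : V → ℝ, (∀ v, 0 < θ v) ∧
      (∀ (v : V) (F : Finset V), (∀ u ∈ F, p u = v) → ∑ u ∈ F, θ u ≤ 1) ∧
      (∀ (v : V) (m : ℝ), (∀ F : Finset V, (∀ u ∈ F, p u = v) → ∑ u ∈ F, θ u ≤ m) → 1 ≤ m) := by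
  have hc : ∀ v, (p ⁻¹' {v}).Countable := by
    intro v
    refine ((hlc v).insert v).mono ?_
    intro u hu
    by_cases h : u = v
    · exact Or.inl h
    · exact Or.inr ⟨hu, h⟩
  choose e he c hsum _ using fun v => (hc v).exists_pos_hasSum_le one_pos
  have hle : ∀ (v : V) (F : Finset V), (∀ u ∈ F, p u = v) → ∑ u ∈ F, e v u ≤ c v := by
    intro v F hF
    have h1 := sum_le_hasSum (F.subtype (· ∈ p ⁻¹' {v})) (fun i _ => (he v i).le) (hsum v)
    rw [Finset.sum_subtype_of_mem (p := (· ∈ p ⁻¹' {v})) (fun u => e v u)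
      (fun u hu => hF u hu)] at h1
    exact h1
  have hcpos : ∀ v, 0 < c v := by
    intro v
    obtain ⟨a, ha⟩ := hl v
    have := hle v {a} (by simpa using ha)
    simp at this
    exact (he v a).trans_le this
  refine ⟨fun u => e (p u) u / c (p u), fun u => div_pos (he _ _) (hcpos _), ?_, ?_⟩
  · intro v F hF
    have : ∑ u ∈ F, e (p u) u / c (p u) = (∑ u ∈ F, e v u) / c v := by
      rw [Finset.sum_div]
      exact Finset.sum_congr rfl fun u hu => by rw [hF u hu]
    rw [this, div_le_one (hcpos v)]
    exact hle v F hF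
  · intro v m h
    have h1 : c v ≤ m * c v := by
      refine hasSum_le_of_sum_le (hsum v) fun s => ?_
      have h2 := h (s.map (Function.Embedding.subtype _)) (by
        intro u hu
        obtain ⟨x, -, rfl⟩ := Finset.mem_map.1 hu
        exact x.2)
      rw [Finset.sum_map] at h2
      have h3 : ∑ x ∈ s, e (p x.1) x.1 / c (p x.1) = (∑ x ∈ s, e v x.1) / c v := by
        rw [Finset.sum_div]
        refine Finset.sum_congr rfl fun x hx => ?_
        have : p x.1 = v := x.2
        rw [this]
      have h4 : (∑ x ∈ s, e v x.1) / c v ≤ m := by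
        rw [← h3]; exact h2
      rwa [div_le_iff₀ (hcpos v)] at h4
    have := hcpos v
    nlinarith

lemma fork_counterexample {V : Type u} (p : V → V) (hforest : IsDirectedForest p)
    (hl : Leafless p) (hlc : LocallyCountable p) (v₀ a b : V) (hv : p v₀ ≠ v₀)
    (ha : p a = v₀) (hb : p b = v₀) (hab : a ≠ b) :
    ∃ (lam : V → ℂ) (S : Hs V →L[ℂ] Hs V), ProperWeights p lam ∧ IsWeightedShift p lam S ∧
      Hyponormal S ∧ ¬ Hyponormal (S ^ 2) := by
  obtain ⟨θ, hpos, hle, hge⟩ := exists_theta p hl hlc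
  have hθ1 : ∀ u, θ u ≤ 1 := fun u => by simpa using hle (p u) {u} (by simp)
  have acyc : ∀ n : ℕ, 1 ≤ n → ∀ v : V, p^[n] v = v → p v = v := hforest.2
  have hanr : p a ≠ a := fun e => hv (by rw [← ha, e, e])
  have hbnr : p b ≠ b := fun e => hv (by rw [← hb, e, e])
  -- no iterate of `v₀` is `b`, `a` or vice versa
  have hnb : ∀ k, p^[k] v₀ ≠ b := by
    intro k e
    apply hbnr
    apply acyc (k + 1) (by omega)
    rw [Function.iterate_succ_apply, hb, e]
  have hna : ∀ k, p^[k] v₀ ≠ a := by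
    intro k e
    apply hanr
    apply acyc (k + 1) (by omega)
    rw [Function.iterate_succ_apply, ha, e]
  have hanb : ∀ k, p^[k] a ≠ b := by
    intro k
    cases k with
    | zero => exact hab
    | succ k => rw [Function.iterate_succ_apply, ha]; exact hnb k
  obtain ⟨B, hB⟩ : ∃ B : ℝ, 1 < θ a * (θ v₀ * (θ b * B)) := by
    have h1 := hpos a
    have h2 := hpos v₀
    have h3 := hpos b
    refine ⟨2 / (θ a * θ v₀ * θ b), ?_⟩
    have : θ a * (θ v₀ * (θ b * (2 / (θ a * θ v₀ * θ b)))) = 2 := by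
      field_simp
    rw [this]
    norm_num
  have hθB : 1 ≤ θ b * B := by
    by_contra hcon
    push Not at hcon
    have h1 : θ v₀ * (θ b * B) < 1 := by nlinarith [hpos v₀, hθ1 v₀]
    nlinarith [hpos a, hθ1 a]
  have hB1 : θ b * B ≤ B := by
    have : 0 < B := by
      by_contra hcon
      push Not at hcon
      nlinarith [hpos b]
    nlinarith [hθ1 b]
  have hB0 : 0 ≤ B := by linarith
  let c : V → ℝ := fun u => if ∃ k, p^[k] u = b then B else if u = v₀ then θ b * B else 1
  have hcb : ∀ u, (∃ k, p^[k] u = b) → c u = B := fun u h => if_pos h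
  have hcv : c v₀ = θ b * B := by
    have : ¬ ∃ k, p^[k] v₀ = b := by
      rintro ⟨k, hk⟩; exact hnb k hk
    simp only [c, if_neg this, if_true]
  have hc1 : ∀ u, (¬ ∃ k, p^[k] u = b) → u ≠ v₀ → c u = 1 := by
    intro u h1 h2
    simp only [c, if_neg h1, if_neg h2]
  have hcge : ∀ u, 1 ≤ c u := by
    intro u
    by_cases h1 : ∃ k, p^[k] u = b
    · rw [hcb u h1]; linarith
    · by_cases h2 : u = v₀
      · rw [h2, hcv]; exact hθB
      · rw [hc1 u h1 h2]
  have hcle : ∀ u, c u ≤ B := by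
    intro u
    by_cases h1 : ∃ k, p^[k] u = b
    · rw [hcb u h1]
    · by_cases h2 : u = v₀
      · rw [h2, hcv]; exact hB1
      · rw [hc1 u h1 h2]; linarith
  let lam : V → ℂ := fun u => if p u = u then 0 else (Real.sqrt (θ u * c u) : ℂ)
  have hlam0 : ∀ u, p u = u → lam u = 0 := fun u h => if_pos h
  have hlam : ∀ u, p u ≠ u → ‖lam u‖ ^ 2 = θ u * c u := by
    intro u h
    have h1 : 0 ≤ θ u * c u := mul_nonneg (hpos u).le (by linarith [hcge u])
    simp only [lam, if_neg h]
    rw [Complex.norm_real, Real.norm_eq_abs, sq_abs, Real.sq_sqrt h1]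
  have hlamle : ∀ u, ‖lam u‖ ^ 2 ≤ θ u * c u := by
    intro u
    by_cases h : p u = u
    · rw [hlam0 u h]
      have := mul_nonneg (hpos u).le (by linarith [hcge u] : (0 : ℝ) ≤ c u)
      simpa using this
    · exact (hlam u h).le
  have fsum : ∀ (v : V) (K : ℝ), 0 ≤ K → (∀ u, p u = v → c u ≤ K) → ∀ F : Finset V,
      (∀ u ∈ F, p u = v) → ∑ u ∈ F, ‖lam u‖ ^ 2 ≤ K := by
    intro v K hK h F hF
    calc ∑ u ∈ F, ‖lam u‖ ^ 2 ≤ ∑ u ∈ F, θ u * K := by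
          refine Finset.sum_le_sum fun u hu => (hlamle u).trans ?_
          exact mul_le_mul_of_nonneg_left (h u (hF u hu)) (hpos u).le
      _ = (∑ u ∈ F, θ u) * K := by rw [Finset.sum_mul]
      _ ≤ 1 * K := by
          gcongr
          exact hle v F hF
      _ = K := one_mul K
  obtain ⟨S, hS⟩ := exists_shift p lam B hB0 (fun v => fsum v B hB0 fun u _ => hcle u)
  -- lower bound of fibre sums
  have lower : ∀ (v : V) (m : ℝ), p v ≠ v → 0 < m → (∀ u, p u = v → m ≤ c u) →
      m ≤ ‖S (ev v)‖ ^ 2 := by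
    intro v m hvr hm h
    have := hge v (‖S (ev v)‖ ^ 2 / m) (by
      intro F hF
      rw [le_div_iff₀ hm, Finset.sum_mul]
      refine le_trans ?_ (fiber_sum_le hS v F hF)
      refine Finset.sum_le_sum fun u hu => ?_
      have hu' := hF u hu
      have : p u ≠ u := by
        intro e
        apply hvr
        rw [← hu', e, e]
      rw [hlam u this]
      exact mul_le_mul_of_nonneg_left (h u hu') (hpos u).le)
    rwa [le_div_iff₀ hm, one_mul] at this
  have hDc : ∀ u, p u ≠ u → c u ≤ ‖S (ev u)‖ ^ 2 := by
    intro u hu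
    by_cases h1 : ∃ k, p^[k] u = b
    · refine lower u _ hu (by linarith [hcge u]) fun x hx => ?_
      obtain ⟨k, hk⟩ := h1
      rw [hcb u ⟨k, hk⟩, hcb x ⟨k + 1, by rw [Function.iterate_succ_apply, hx, hk]⟩]
    · by_cases h2 : u = v₀
      · subst h2
        have := fiber_sum_le hS u {b} (by simpa using hb)
        rw [Finset.sum_singleton, hlam b hbnr, hcb b ⟨0, rfl⟩] at this
        rw [hcv]
        exact this
      · rw [hc1 u h1 h2]
        exact lower u 1 hu one_pos fun x _ => hcge x
  have hlamD : ∀ u, ‖lam u‖ ≤ Real.sqrt (θ u) * ‖S (ev u)‖ := by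
    intro u
    by_cases h : p u = u
    · rw [hlam0 u h, norm_zero]
      positivity
    · rw [← sq_le_sq₀ (norm_nonneg _) (by positivity), mul_pow, Real.sq_sqrt (hpos u).le,
        hlam u h]
      exact mul_le_mul_of_nonneg_left (hDc u h) (hpos u).le
  refine ⟨lam, S, ?_, hS, ?_, ?_⟩
  · intro u
    constructor
    · intro h
      by_contra hr
      have := hlam u hr
      rw [h] at this
      have h2 := mul_pos (hpos u) (by linarith [hcge u] : (0 : ℝ) < c u)
      simp at this
      rcases this with h3 | h3
      · exact (hpos u).ne' h3
      · linarith [hcge u]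
    · exact hlam0 u
  · rw [crit hS]
    intro v F f hF
    calc ‖∑ u ∈ F, starRingEnd ℂ (lam u) * f u‖ ^ 2
        ≤ (∑ u ∈ F, Real.sqrt (θ u) * (‖f u‖ * ‖S (ev u)‖)) ^ 2 := by
          gcongr
          refine (norm_sum_le _ _).trans (Finset.sum_le_sum fun u hu => ?_)
          rw [norm_mul, RCLike.norm_conj]
          calc ‖lam u‖ * ‖f u‖ ≤ (Real.sqrt (θ u) * ‖S (ev u)‖) * ‖f u‖ := by
                gcongr
                exact hlamD u
            _ = _ := by ring
      _ ≤ (∑ u ∈ F, Real.sqrt (θ u) ^ 2) * ∑ u ∈ F, (‖f u‖ * ‖S (ev u)‖) ^ 2 :=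
          Finset.sum_mul_sq_le_sq_mul_sq _ _ _
      _ ≤ 1 * ∑ u ∈ F, (‖f u‖ * ‖S (ev u)‖) ^ 2 := by
          have h1 : ∑ u ∈ F, Real.sqrt (θ u) ^ 2 ≤ 1 := by
            refine le_trans (le_of_eq ?_) (hle v F hF)
            exact Finset.sum_congr rfl fun u _ => Real.sq_sqrt (hpos u).le
          have h2 : 0 ≤ ∑ u ∈ F, (‖f u‖ * ‖S (ev u)‖) ^ 2 :=
            Finset.sum_nonneg fun _ _ => sq_nonneg _
          exact mul_le_mul_of_nonneg_right h1 h2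
      _ = _ := by simp only [one_mul, mul_pow]
  · intro hyp
    have h1 := (crit (pow_shift hS 2)).1 hyp (p^[2] a) {a} (fun _ => 1) (by simp)
    simp only [Finset.sum_singleton, mul_one, norm_one, one_pow, one_mul, RCLike.norm_conj] at h1
    have hw : iterWeight p lam 2 a = lam v₀ * lam a := by
      simp [iterWeight, ha]
    -- vertices at and above level one below `a`
    have desc : ∀ (k : ℕ) (x : V), p^[k + 1] x = a → (∀ i, i ≤ k → p^[i] x ≠ b) → c x = 1 := by
      intro k x hx hi
      refine hc1 x ?_ ?_
      · rintro ⟨j, hj⟩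
        by_cases hjk : j ≤ k
        · exact hi j hjk hj
        · obtain ⟨d, rfl⟩ : ∃ d, j = d + (k + 1) := ⟨j - (k + 1), by omega⟩
          rw [Function.iterate_add_apply, hx] at hj
          exact hanb d hj
      · rintro rfl
        exact hna _ hx
    have hpb : ∀ i, p^[i + 1] b ≠ a := by
      intro i e
      rw [Function.iterate_succ_apply, hb] at e
      exact hna i e
    have n1 : ‖S (ev a)‖ ^ 2 ≤ 1 * ‖ev a‖ ^ 2 := by
      refine norm_shift_sq_le hS _ 1 zero_le_one fun v hv1 => ?_
      have hva : v = a := by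
        by_contra h
        exact hv1 (by rw [ev_apply, if_neg h])
      subst hva
      refine fsum v 1 zero_le_one fun x hx => le_of_eq (desc 0 x hx ?_)
      intro i hi e
      have : i = 0 := by omega
      subst this
      apply hpb 0
      rw [← e]
      exact hx
    have n2 : ‖S (S (ev a))‖ ^ 2 ≤ 1 * ‖S (ev a)‖ ^ 2 := by
      refine norm_shift_sq_le hS _ 1 zero_le_one fun v hv1 => ?_
      have hva : p v = a := by
        by_contra h
        exact hv1 (by rw [hS, ev_apply, if_neg h, mul_zero])
      refine fsum v 1 zero_le_one fun x hx => le_of_eq (desc 1 x (by simp [hx, hva]) ?_)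
      intro i hi e
      interval_cases i
      · apply hpb 1
        rw [← e]
        simp [hx, hva]
      · apply hpb 0
        rw [← e]
        simp [hx, hva]
    have hS2 : (S ^ 2) (ev a) = S (S (ev a)) := by
      rw [pow_two]
      rfl
    rw [hw, norm_mul, mul_pow, hlam v₀ hv, hlam a hanr, hcv, hS2] at h1
    rw [norm_ev] at n1
    have hca : c a = 1 := hc1 a (by rintro ⟨k, hk⟩; exact hanb k hk) (by
      intro e
      exact hanr (by rw [ha, e]))
    rw [hca] at h1
    nlinarith

/-- Theorem (only-stars): for a leafless, locally countable directed forest, the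
conditions (a) every bounded hyponormal weighted shift is power hyponormal,
(b) the square of every bounded hyponormal weighted shift is hyponormal, and
(c) the forest is forkless, are all equivalent; (a) and (b) remain equivalent to (c)
when restricted to proper weighted shifts. -/
theorem onlyStars {V : Type u} (p : V → V) (hforest : IsDirectedForest p)
    (hleafless : Leafless p) (hlc : LocallyCountable p) :
    ((∀ (lam : V → ℂ) (S : Hs V →L[ℂ] Hs V),
        WeightSystem p lam → IsWeightedShift p lam S → Hyponormal S →
          PowerHyponormal S) ↔ Forkless p) ∧
    ((∀ (lam : V → ℂ) (S : Hs V →L[ℂ] Hs V),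
        WeightSystem p lam → IsWeightedShift p lam S → Hyponormal S →
          Hyponormal (S ^ 2)) ↔ Forkless p) ∧
    ((∀ (lam : V → ℂ) (S : Hs V →L[ℂ] Hs V),
        ProperWeights p lam → IsWeightedShift p lam S → Hyponormal S →
          PowerHyponormal S) ↔ Forkless p) ∧
    ((∀ (lam : V → ℂ) (S : Hs V →L[ℂ] Hs V),
        ProperWeights p lam → IsWeightedShift p lam S → Hyponormal S →
          Hyponormal (S ^ 2)) ↔ Forkless p) := by
  have hA : Forkless p → ∀ (lam : V → ℂ) (S : Hs V →L[ℂ] Hs V),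
      WeightSystem p lam → IsWeightedShift p lam S → Hyponormal S → PowerHyponormal S :=
    fun hfk lam S hw hS hyp => forkless_power hfk hleafless hw hS hyp
  have hB : (∀ (lam : V → ℂ) (S : Hs V →L[ℂ] Hs V),
      ProperWeights p lam → IsWeightedShift p lam S → Hyponormal S →
        Hyponormal (S ^ 2)) → Forkless p := by
    intro h v hv
    obtain ⟨a, ha⟩ := hleafless v
    have hav : a ≠ v := by
      rintro rfl
      exact hv ha
    refine ⟨a, ⟨ha, hav⟩, ?_⟩
    rintro b ⟨hb, -⟩
    by_contra hba
    obtain ⟨lam, S, h1, h2, h3, h4⟩ :=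
      fork_counterexample p hforest hleafless hlc v a b hv ha hb (fun e => hba e.symm)
    exact h4 (h lam S h1 h2 h3)
  have hpw : ∀ lam : V → ℂ, ProperWeights p lam → WeightSystem p lam :=
    fun lam h v hv => (h v).2 hv
  have h12 : (1 : ℕ) ≤ 2 := one_le_two
  refine ⟨⟨fun h => hB fun lam S h1 h2 h3 => h lam S (hpw lam h1) h2 h3 2 h12, hA⟩,
    ⟨fun h => hB fun lam S h1 h2 h3 => h lam S (hpw lam h1) h2 h3,
      fun h lam S h1 h2 h3 => hA h lam S h1 h2 h3 2 h12⟩,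
    ⟨fun h => hB fun lam S h1 h2 h3 => h lam S h1 h2 h3 2 h12,
      fun h lam S h1 h2 h3 => hA h lam S (hpw lam h1) h2 h3⟩,
    ⟨hB, fun h lam S h1 h2 h3 => hA h lam S (hpw lam h1) h2 h3 2 h12⟩⟩

end ShiftsPaper
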